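/- Let M ∈ ℝⁿˣⁿ be a symmetric positive definite matrix and define the weighted squared norm ‖v‖²_M = vᵀMv on ℝⁿ. Let n_s ≥ 1 and θ* ∈ ℝᵖ. For each i = 1, …, n_s, let Jᵢ : ℝⁿ × ℝᵖ → ℝ be twice continuously differentiable, let mᵢ ∈ ℝⁿ be a fixed vector, and let mᵢ* : ℝᵖ → ℝⁿ be differentiable at θ* with ∇ₘJᵢ(mᵢ*(θ), θ) = 0 for all θ in a neighborhood of θ*, and suppose the Hessian Hᵢ = ∂²Jᵢ/∂m²(mᵢ*(θ*), θ*) is invertible. Then the sample-average Bayes risk Ψ(θ) = (1/n_s) Σᵢ₌₁^{n_s} ‖mᵢ*(θ) − mᵢ‖²_M is differentiable at θ* with gradient ∇Ψ(θ*) = −(2/n_s) Σᵢ₌₁^{n_s} Bᵢᵀ Hᵢ⁻¹ M (mᵢ*(θ*) − mᵢ), where Bᵢ = ∂²Jᵢ/∂m∂θ(mᵢ*(θ*), θ*). -/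

import Mathlib

open Topology Matrix Finset

section
variable {E P : Type*} [NormedAddCommGroup E] [InnerProductSpace ℝ E] [CompleteSpace E]
  [NormedAddCommGroup P] [NormedSpace ℝ P]

theorem gradient_partial_eq_toDual_symm {J : E × P → ℝ} (hJ : ContDiff ℝ 2 J) (x : E × P) :
    gradient (fun m' => J (m', x.2)) x.1 =
      (InnerProductSpace.toDual ℝ E).symm
        ((fderiv ℝ J x).comp (ContinuousLinearMap.inl ℝ E P)) := by
  have h : HasFDerivAt J (fderiv ℝ J x) (x.1, x.2) :=
    (hJ.differentiable two_ne_zero x).hasFDerivAt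
  have h' := HasFDerivAt.comp x.1 h (hasFDerivAt_prodMk_left (𝕜 := ℝ) x.1 x.2)
  rw [gradient]
  exact congrArg _ h'.fderiv

theorem differentiable_gradient_partial {J : E × P → ℝ} (hJ : ContDiff ℝ 2 J) :
    Differentiable ℝ (fun x : E × P => gradient (fun m' => J (m', x.2)) x.1) := by
  simp_rw [gradient_partial_eq_toDual_symm hJ]
  have h1 : Differentiable ℝ (fderiv ℝ J) :=
    (hJ.fderiv_right (m := 1) (by norm_num)).differentiable one_ne_zero
  exact (InnerProductSpace.toDual ℝ E).symm.differentiable.comp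
    (h1.clm_comp (differentiable_const _))

theorem inner_fderiv_gradient_comm {f : E → ℝ} (hf : ContDiff ℝ 2 f) (x u w : E) :
    inner ℝ (fderiv ℝ (gradient f) x u) w = inner ℝ u (fderiv ℝ (gradient f) x w) := by
  have h1 : DifferentiableAt ℝ (fderiv ℝ f) x :=
    (hf.fderiv_right (m := 1) (by norm_num)).differentiable one_ne_zero x
  have h2 : DifferentiableAt ℝ (gradient f) x :=
    (InnerProductSpace.toDual ℝ E).symm.differentiable.differentiableAt.comp x h1
  have h3 : ∀ a b : E, inner ℝ (fderiv ℝ (gradient f) x a) b =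
      fderiv ℝ (fderiv ℝ f) x a b := by
    intro a b
    have e : (fun y => inner ℝ (gradient f y) b) = fun y => fderiv ℝ f y b := by
      ext y
      exact InnerProductSpace.toDual_symm_apply
    have k1 := (h2.hasFDerivAt.inner ℝ (hasFDerivAt_const b x)).fderiv
    have k2 := (h1.hasFDerivAt.clm_apply (hasFDerivAt_const b x)).fderiv
    rw [e, k2] at k1
    simpa [fderivInnerCLM_apply] using (DFunLike.congr_fun k1 a).symm
  have hs := hf.contDiffAt.isSymmSndFDerivAt (x := x) (by simp)
  rw [real_inner_comm _ u, h3, h3]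
  exact hs.eq u w

end

/-- Implicit differentiation along a curve of zeros. -/
theorem fderiv_apply_fderiv_of_eventually_eq_zero {E P F : Type*}
    [NormedAddCommGroup E] [NormedSpace ℝ E] [NormedAddCommGroup P] [NormedSpace ℝ P]
    [NormedAddCommGroup F] [NormedSpace ℝ F] {G : E × P → F} {c : P → E} {t : P}
    (hG : DifferentiableAt ℝ G (c t, t)) (hc : DifferentiableAt ℝ c t)
    (h0 : ∀ᶠ s in 𝓝 t, G (c s, s) = 0) (v : P) :
    fderiv ℝ (fun e => G (e, t)) (c t) (fderiv ℝ c t v) =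
      -fderiv ℝ (fun s => G (c t, s)) t v := by
  have h1 := hG.hasFDerivAt.comp (c t) (hasFDerivAt_prodMk_left (𝕜 := ℝ) (c t) t)
  have h2 := hG.hasFDerivAt.comp t (hasFDerivAt_prodMk_right (𝕜 := ℝ) (c t) t)
  have h3 := HasFDerivAt.comp (f := fun s => (c s, s)) t hG.hasFDerivAt
    (hc.hasFDerivAt.prodMk (hasFDerivAt_id t))
  have h4 : fderiv ℝ (fun s => G (c s, s)) t = 0 := by
    rw [Filter.EventuallyEq.fderiv_eq (f := fun _ => (0 : F)) h0]
    simp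
  have h5 := congrArg (fun L => L v) (h3.fderiv.symm.trans h4)
  have e1 := congrArg (fun L => L (fderiv ℝ c t v)) h1.fderiv
  have e2 := congrArg (fun L => L v) h2.fderiv
  simp only [Function.comp_def] at e1 e2
  rw [e1, e2, eq_neg_iff_add_eq_zero]
  simpa [← map_add] using h5

theorem hasFDerivAt_dotProduct_mulVec {n : ℕ} {P : Type*} [NormedAddCommGroup P]
    [NormedSpace ℝ P] {M : Matrix (Fin n) (Fin n) ℝ} (hM : M.IsSymm)
    {c : P → EuclideanSpace ℝ (Fin n)} {c' : P →L[ℝ] EuclideanSpace ℝ (Fin n)} {t : P}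
    (hc : HasFDerivAt c c' t) :
    HasFDerivAt (fun s => (c s).ofLp ⬝ᵥ (M *ᵥ (c s).ofLp))
      ((2 : ℝ) • (innerSL ℝ (WithLp.toLp 2 (M *ᵥ (c t).ofLp))).comp c') t := by
  let T := Matrix.toEuclideanCLM (𝕜 := ℝ) M
  have hT : ∀ x y : EuclideanSpace ℝ (Fin n), inner ℝ x (T y) = x.ofLp ⬝ᵥ (M *ᵥ y.ofLp) := by
    intro x y
    simp [T, EuclideanSpace.inner_eq_star_dotProduct, dotProduct_comm]
  have h := hc.inner ℝ (T.hasFDerivAt.comp t hc)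
  simp only [Function.comp_apply, hT] at h
  refine h.congr_fderiv ?_
  ext v
  have hsymm : (c' v).ofLp ⬝ᵥ (M *ᵥ (c t).ofLp) = (c t).ofLp ⬝ᵥ (M *ᵥ (c' v).ofLp) := by
    rw [dotProduct_mulVec, ← mulVec_transpose, hM.eq, dotProduct_comm]
  simp [fderivInnerCLM_apply, hT, EuclideanSpace.inner_eq_star_dotProduct, hsymm]
  ring

/-- **Sensitivity operator of the approximate Bayes risk:
`D^R = (2/n_s) Σᵢ (−Bᵢᵀ Hᵢ⁻¹ M (mᵢ* − mᵢ))`.**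
For each sample `i`, `Jᵢ` is a `C²` cost functional whose stationary point (MAP point)
`mᵢ*(θ)` is differentiable at `θ*` with invertible Hessian `Hᵢ`.  Then the sample-average
Bayes risk `Ψ(θ) = (1/n_s) Σᵢ ‖mᵢ*(θ) − mᵢ‖²_M` is differentiable at `θ*` and its gradient
is `−(2/n_s) Σᵢ Bᵢᵀ Hᵢ⁻¹ M (mᵢ*(θ*) − mᵢ)`; equivalently, its derivative in any direction
`v` is `−(2/n_s) Σᵢ (Hᵢ⁻¹ M (mᵢ*(θ*) − mᵢ)) ⬝ᵥ (Bᵢ v)`. -/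
theorem bayes_risk_sensitivity_operator
    (n p ns : ℕ) (hns : 1 ≤ ns)
    (M : Matrix (Fin n) (Fin n) ℝ) (hMsymm : M.IsSymm) (hMpos : M.PosDef)
    (θstar : EuclideanSpace ℝ (Fin p))
    (J : Fin ns → (EuclideanSpace ℝ (Fin n) × EuclideanSpace ℝ (Fin p) → ℝ))
    (hJ : ∀ i, ContDiff ℝ 2 (J i))
    (m : Fin ns → EuclideanSpace ℝ (Fin n))
    (mstar : Fin ns → EuclideanSpace ℝ (Fin p) → EuclideanSpace ℝ (Fin n))
    (hdiff : ∀ i, DifferentiableAt ℝ (mstar i) θstar)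
    -- the gradient of `Jᵢ` with respect to the first variable `m`
    (gradm : Fin ns → EuclideanSpace ℝ (Fin n) → EuclideanSpace ℝ (Fin p) →
      EuclideanSpace ℝ (Fin n))
    (hgradm : ∀ i mm θ, gradm i mm θ = gradient (fun m' => J i (m', θ)) mm)
    -- stationarity: `∇ₘ Jᵢ (mᵢ*(θ), θ) = 0` for `θ` near `θ*`
    (hstat : ∀ i, ∀ᶠ θ in 𝓝 θstar, gradm i (mstar i θ) θ = 0)
    -- the Hessians `Hᵢ = ∂²Jᵢ/∂m² (mᵢ*(θ*), θ*)`, assumed invertible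
    (H : Fin ns → (EuclideanSpace ℝ (Fin n) →L[ℝ] EuclideanSpace ℝ (Fin n)))
    (hH : ∀ i, H i = fderiv ℝ (fun mm => gradm i mm θstar) (mstar i θstar))
    (Hinv : Fin ns → (EuclideanSpace ℝ (Fin n) ≃L[ℝ] EuclideanSpace ℝ (Fin n)))
    (hHinv : ∀ i, ((Hinv i : EuclideanSpace ℝ (Fin n) →L[ℝ] EuclideanSpace ℝ (Fin n))) = H i)
    -- the mixed second derivatives `Bᵢ = ∂²Jᵢ/∂m∂θ (mᵢ*(θ*), θ*)`
    (B : Fin ns → (EuclideanSpace ℝ (Fin p) →L[ℝ] EuclideanSpace ℝ (Fin n)))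
    (hB : ∀ i, B i = fderiv ℝ (fun θ => gradm i (mstar i θstar) θ) θstar)
    -- the sample-average Bayes risk
    (Ψ : EuclideanSpace ℝ (Fin p) → ℝ)
    (hΨ : ∀ θ, Ψ θ = (1 / (ns : ℝ)) *
      ∑ i, (mstar i θ - m i) ⬝ᵥ (M *ᵥ (mstar i θ - m i))) :
    DifferentiableAt ℝ Ψ θstar ∧
      ∀ v : EuclideanSpace ℝ (Fin p),
        fderiv ℝ Ψ θstar v =
          (-(2 / (ns : ℝ))) *
            ∑ i, ((Hinv i).symm (WithLp.toLp 2 (M *ᵥ (mstar i θstar - m i)))) ⬝ᵥ (B i v) := by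
  have hJ1 : ∀ i, ContDiff ℝ 2 (fun m' => J i (m', θstar)) := fun i =>
    (hJ i).comp (contDiff_prodMk_left θstar)
  have himp : ∀ i v, Hinv i (fderiv ℝ (mstar i) θstar v) = -B i v := by
    intro i v
    have h := fderiv_apply_fderiv_of_eventually_eq_zero
      (differentiable_gradient_partial (hJ i) (mstar i θstar, θstar)) (hdiff i)
      (by simpa only [hgradm] using hstat i) v
    rw [← ContinuousLinearEquiv.coe_coe, hHinv, hH, hB]
    simpa only [hgradm] using h
  have hsymm : ∀ i u w, inner ℝ (Hinv i u) w = inner ℝ u (Hinv i w) := by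
    intro i u w
    have h := inner_fderiv_gradient_comm (hJ1 i) (mstar i θstar) u w
    rw [← ContinuousLinearEquiv.coe_coe, hHinv, hH]
    simpa only [hgradm] using h
  have hderiv := (HasFDerivAt.fun_sum (u := univ) fun i _ =>
    hasFDerivAt_dotProduct_mulVec hMsymm ((hdiff i).hasFDerivAt.sub_const (m i))).const_mul
      (1 / (ns : ℝ))
  have hΨ' := hderiv.congr_of_eventuallyEq (f₁ := Ψ) (.of_forall hΨ)
  refine ⟨hΨ'.differentiableAt, fun v => ?_⟩
  rw [hΨ'.fderiv]
  have hterm : ∀ i, inner ℝ (WithLp.toLp 2 (M *ᵥ (mstar i θstar - m i).ofLp))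
      (fderiv ℝ (mstar i) θstar v) =
      -(((Hinv i).symm (WithLp.toLp 2 (M *ᵥ (mstar i θstar - m i).ofLp))).ofLp ⬝ᵥ
        (B i v).ofLp) := by
    intro i
    generalize WithLp.toLp 2 (M *ᵥ (mstar i θstar - m i).ofLp) = w
    have h := hsymm i ((Hinv i).symm w) (fderiv ℝ (mstar i) θstar v)
    rw [himp, ContinuousLinearEquiv.apply_symm_apply, inner_neg_right] at h
    rw [h, EuclideanSpace.inner_eq_star_dotProduct, star_trivial, dotProduct_comm]
  simp only [_root_.smul_apply, _root_.sum_apply,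
    ContinuousLinearMap.comp_apply, innerSL_apply_apply, smul_eq_mul, hterm, mul_neg,
    sum_neg_distrib, ← mul_sum]
  simp only [WithLp.ofLp_sub]
  ring
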